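/- Let v be a valuation on a field K, L an algebraic extension of K, and R the integral closure of the valuation ring O_v in L. The maps I ↦ R_I (localization of R at I inside L) and O_w ↦ m_w ∩ R are mutually inverse bijections between the set of maximal ideals of R and the set of valuation rings of L extending O_v. -/

import Mathlib

open Polynomial in
/-- An algebraic element satisfies a polynomial with coefficients in the valuation ring,
with a last unit coefficient. -/
lemma aux_poly {K L Γ₀ : Type*} [Field K] [Field L] [Algebra K L] [Algebra.IsAlgebraic K L]
    [LinearOrderedCommGroupWithZero Γ₀] (v : Valuation K Γ₀) (x : L) :
    ∃ (q : K[X]) (r : ℕ), aeval x q = 0 ∧ (∀ i, v (q.coeff i) ≤ 1) ∧ v (q.coeff r) = 1 ∧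
      ∀ i, r < i → v (q.coeff i) < 1 := by
  obtain ⟨p, hp, hpx⟩ := Algebra.IsAlgebraic.isAlgebraic (R := K) x
  obtain ⟨m, hm, hmax⟩ := Finset.exists_max_image p.support (fun i => v (p.coeff i))
    (Polynomial.support_nonempty.mpr hp)
  have hm0 : p.coeff m ≠ 0 := Polynomial.mem_support_iff.mp hm
  have hle : ∀ i, v (p.coeff i) ≤ v (p.coeff m) := by
    intro i
    by_cases hi : i ∈ p.support
    · exact hmax i hi
    · rw [Polynomial.notMem_support_iff.mp hi]; simp
  have hvm : 0 < v (p.coeff m) := by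
    rw [zero_lt_iff]; exact (Valuation.ne_zero_iff v).mpr hm0
  set q := C (p.coeff m)⁻¹ * p with hq
  have hqc : ∀ i, v (q.coeff i) ≤ 1 := by
    intro i
    rw [hq, coeff_C_mul, map_mul, map_inv₀, inv_mul_le_iff₀ hvm, mul_one]
    exact hle i
  have hqm : v (q.coeff m) = 1 := by
    rw [hq, coeff_C_mul, inv_mul_cancel₀ hm0, map_one]
  have hne : (q.support.filter (fun i => v (q.coeff i) = 1)).Nonempty := by
    refine ⟨m, ?_⟩
    rw [Finset.mem_filter, Polynomial.mem_support_iff]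
    refine ⟨fun h => ?_, hqm⟩
    rw [h] at hqm; simp at hqm
  refine ⟨q, (q.support.filter (fun i => v (q.coeff i) = 1)).max' hne, ?_, hqc, ?_, ?_⟩
  · rw [hq, map_mul, hpx, mul_zero]
  · exact (Finset.mem_filter.mp (Finset.max'_mem _ hne)).2
  · intro i hi
    refine lt_of_le_of_ne (hqc i) fun h => ?_
    refine absurd (Finset.le_max' _ i ?_) (not_le.mpr hi)
    rw [Finset.mem_filter, Polynomial.mem_support_iff]
    refine ⟨fun h' => ?_, h⟩
    rw [h'] at h; simp at h

/-- Tails of an algebraic relation lie in every valuation ring containing the coefficients. -/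
lemma aux_tail {L : Type*} [Field L] (V : ValuationSubring L) (c : ℕ → L) (hc : ∀ i, c i ∈ V)
    (x : L) (k n : ℕ) (h : ∑ i ∈ Finset.range (k + n), c i * x ^ i = 0) :
    (∑ i ∈ Finset.range n, c (k + i) * x ^ i) ∈ V ∧
    (∑ i ∈ Finset.range n, c (k + i) * x ^ i) * x ∈ V := by
  set z := ∑ i ∈ Finset.range n, c (k + i) * x ^ i with hz
  have hrel : (∑ i ∈ Finset.range k, c i * x ^ i) + x ^ k * z = 0 := by
    rw [← h, Finset.sum_range_add, hz, Finset.mul_sum]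
    congr 1
    refine Finset.sum_congr rfl fun i _ => ?_
    ring
  by_cases hx : x ∈ V
  · have : z ∈ V := sum_mem fun i _ => mul_mem (hc _) (pow_mem hx _)
    exact ⟨this, mul_mem this hx⟩
  · have hx' : x⁻¹ ∈ V := (V.mem_or_inv_mem x).resolve_left hx
    have hx0 : x ≠ 0 := by rintro rfl; exact hx V.zero_mem
    have key : z * x ∈ V := by
      cases k with
      | zero =>
        have : z = 0 := by simpa using hrel
        rw [this, zero_mul]; exact V.zero_mem
      | succ k =>
        have : z * x = - ∑ i ∈ Finset.range (k + 1), c i * x⁻¹ ^ (k - i) := by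
          have h1 : x ^ k * (z * x) = x ^ k * - ∑ i ∈ Finset.range (k + 1), c i * x⁻¹ ^ (k - i) := by
            have : x ^ k * ∑ i ∈ Finset.range (k + 1), c i * x⁻¹ ^ (k - i)
                = ∑ i ∈ Finset.range (k + 1), c i * x ^ i := by
              rw [Finset.mul_sum]
              refine Finset.sum_congr rfl fun i hi => ?_
              have hik : i ≤ k := Nat.lt_succ_iff.mp (Finset.mem_range.mp hi)
              have h2 : x ^ k = x ^ i * x ^ (k - i) := by rw [← pow_add]; congr 1; omega
              have h3 : x ^ (k - i) * x⁻¹ ^ (k - i) = 1 := by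
                rw [← mul_pow, mul_inv_cancel₀ hx0, one_pow]
              rw [h2]
              linear_combination (x ^ i * c i) * h3
            rw [mul_neg, this]
            linear_combination hrel
          exact mul_left_cancel₀ (pow_ne_zero k hx0) h1
        rw [this]
        exact neg_mem (sum_mem fun i _ => mul_mem (hc _) (pow_mem hx' _))
    refine ⟨?_, key⟩
    have : z = z * x * x⁻¹ := by field_simp
    rw [this]; exact mul_mem key hx'

section aux
variable {K L Γ₀ : Type*} [Field K] [Field L] [Algebra K L]
    [LinearOrderedCommGroupWithZero Γ₀] (v : Valuation K Γ₀)
    [Algebra v.valuationSubring L] [IsScalarTower v.valuationSubring K L]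

lemma aux_algebraMap (a : v.valuationSubring) :
    algebraMap v.valuationSubring L a = algebraMap K L (a : K) :=
  IsScalarTower.algebraMap_apply v.valuationSubring K L a

lemma aux_mem_iff (W : ValuationSubring L) (hW : W.comap (algebraMap K L) = v.valuationSubring)
    (a : K) : algebraMap K L a ∈ W ↔ v a ≤ 1 := by
  rw [← Valuation.mem_valuationSubring_iff, ← hW]; rfl

lemma aux_nonunit_iff (W : ValuationSubring L)
    (hW : W.comap (algebraMap K L) = v.valuationSubring)
    (a : K) : algebraMap K L a ∈ W.nonunits ↔ v a < 1 := by
  rw [ValuationSubring.mem_nonunits_iff_or, ← map_inv₀, aux_mem_iff v W hW, map_eq_zero, map_inv₀]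
  by_cases ha : a = 0
  · simp [ha]
  · have : 0 < v a := by rw [zero_lt_iff]; exact (Valuation.ne_zero_iff v).mpr ha
    simp only [ha, false_or]
    rw [inv_le_one₀ this, not_le]

/-- The integral closure is contained in each valuation ring above. -/
lemma aux_le (W : ValuationSubring L) (hW : ∀ a : K, v a ≤ 1 → algebraMap K L a ∈ W)
    (r : integralClosure v.valuationSubring L) : (r : L) ∈ W := by
  obtain ⟨p, hp, hpr⟩ := r.2
  let f : v.valuationSubring →+* W :=
    (algebraMap v.valuationSubring L).codRestrict W.toSubring (fun a => by
      rw [aux_algebraMap v]; exact hW _ a.2)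
  have hr : IsIntegral W (r : L) := by
    refine ⟨p.map f, hp.map f, ?_⟩
    rw [Polynomial.eval₂_map]
    exact hpr
  obtain ⟨y, hy⟩ := IsIntegrallyClosed.isIntegral_iff.mp hr
  rw [← hy]; exact y.2

lemma aux_integral (z : L) (h : ∀ V : ValuationSubring L,
    (∀ a : K, v a ≤ 1 → algebraMap K L a ∈ V) → z ∈ V) :
    z ∈ integralClosure v.valuationSubring L := by
  by_contra hz
  have : IsIntegrallyClosedIn (integralClosure v.valuationSubring L).toSubring L :=
    inferInstanceAs (IsIntegrallyClosedIn (integralClosure v.valuationSubring L) L)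
  obtain ⟨V, hV, hzV⟩ := Subring.exists_le_valuationSubring_of_isIntegrallyClosedIn
    (R := (integralClosure v.valuationSubring L).toSubring) (x := z) hz
  refine hzV (h V fun a ha => hV ?_)
  have := (integralClosure v.valuationSubring L).algebraMap_mem ⟨a, ha⟩
  rwa [aux_algebraMap v] at this

lemma aux_key [Algebra.IsAlgebraic K L] (W : ValuationSubring L)
    (hW : W.comap (algebraMap K L) = v.valuationSubring) (x : L) (hx : x ∈ W) :
    ∃ a b : integralClosure v.valuationSubring L, (b : L) ∉ W.nonunits ∧ (b : L) * x = a := by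
  obtain ⟨q, r, hqx, hq1, hqr, hlt⟩ := aux_poly v x
  have hsum : ∑ i ∈ Finset.range (r + (q.natDegree + 1)), algebraMap K L (q.coeff i) * x ^ i = 0 := by
    rw [← hqx, Polynomial.aeval_eq_sum_range' (n := r + (q.natDegree + 1)) (by omega)]
    simp [Algebra.smul_def]
  have ht := fun (V : ValuationSubring L) (hV : ∀ a : K, v a ≤ 1 → algebraMap K L a ∈ V) =>
    aux_tail V (fun i => algebraMap K L (q.coeff i)) (fun i => hV _ (hq1 i)) x r
      (q.natDegree + 1) hsum
  refine ⟨⟨_, aux_integral v _ fun V hV => (ht V hV).2⟩,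
    ⟨_, aux_integral v _ fun V hV => (ht V hV).1⟩, ?_, rfl⟩
  change (∑ i ∈ Finset.range (q.natDegree + 1), algebraMap K L (q.coeff (r + i)) * x ^ i) ∉ _
  rw [Finset.sum_range_succ']
  simp only [pow_zero, mul_one, add_zero]
  intro hmem
  have h1 : (∑ i ∈ Finset.range q.natDegree,
      algebraMap K L (q.coeff (r + (i + 1))) * x ^ (i + 1)) ∈ W.nonunits := by
    refine sum_mem fun i _ => ?_
    have h2 := (aux_nonunit_iff v W hW _).mpr (hlt (r + (i + 1)) (by omega))
    rw [ValuationSubring.mem_nonunits_iff] at h2 ⊢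
    rw [map_mul]
    exact mul_lt_one_of_lt_of_le h2 ((W.valuation_le_one_iff _).mpr (pow_mem hx _))
  have h3 := sub_mem hmem h1
  rw [add_sub_cancel_left, aux_nonunit_iff v W hW, hqr] at h3
  exact lt_irrefl _ h3

/-- The inclusion of the integral closure in a valuation ring above. -/
def auxIncl (W : ValuationSubring L) (hW : W.comap (algebraMap K L) = v.valuationSubring) :
    integralClosure v.valuationSubring L →+* W :=
  ((integralClosure v.valuationSubring L).val.toRingHom).codRestrict W.toSubring
    (fun r => aux_le v W (fun a ha => (aux_mem_iff v W hW a).mpr ha) r)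

/-- The contraction of the maximal ideal. -/
def auxIdeal (W : ValuationSubring L) (hW : W.comap (algebraMap K L) = v.valuationSubring) :
    Ideal (integralClosure v.valuationSubring L) :=
  (IsLocalRing.maximalIdeal W).comap (auxIncl v W hW)

lemma mem_auxIdeal (W : ValuationSubring L)
    (hW : W.comap (algebraMap K L) = v.valuationSubring)
    (r : integralClosure v.valuationSubring L) :
    r ∈ auxIdeal v W hW ↔ (r : L) ∈ W.nonunits :=
  (ValuationSubring.coe_mem_nonunits_iff (a := auxIncl v W hW r)).symm

lemma aux_mem_maximal (a : v.valuationSubring) :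
    a ∈ IsLocalRing.maximalIdeal v.valuationSubring ↔ v (a : K) < 1 := by
  rw [← ValuationSubring.coe_mem_nonunits_iff]
  exact aux_nonunit_iff (L := K) v v.valuationSubring rfl (a : K)

lemma auxIdeal_isMaximal (W : ValuationSubring L)
    (hW : W.comap (algebraMap K L) = v.valuationSubring) : (auxIdeal v W hW).IsMaximal := by
  have hp : (auxIdeal v W hW).IsPrime := Ideal.comap_isPrime _ _
  refine Ideal.isMaximal_of_isIntegral_of_isMaximal_comap (R := v.valuationSubring) _ ?_
  have : (auxIdeal v W hW).comap (algebraMap v.valuationSubring _)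
      = IsLocalRing.maximalIdeal v.valuationSubring := by
    ext a
    rw [Ideal.mem_comap, mem_auxIdeal, aux_mem_maximal, ← aux_nonunit_iff v W hW,
      ← aux_algebraMap v]
    rfl
  rw [this]; infer_instance

lemma aux_exists (I : Ideal (integralClosure v.valuationSubring L)) (hI : I.IsMaximal) :
    ∃ (W : ValuationSubring L) (hW : W.comap (algebraMap K L) = v.valuationSubring),
      auxIdeal v W hW = I := by
  obtain ⟨W, hle, hIW⟩ := Ideal.image_subset_nonunits_valuationSubring
    (A := (integralClosure v.valuationSubring L).toSubring) I hI.ne_top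
  have hO : ∀ a : K, v a ≤ 1 → algebraMap K L a ∈ W := fun a ha => hle (by
    have := (integralClosure v.valuationSubring L).algebraMap_mem ⟨a, ha⟩
    rwa [aux_algebraMap v] at this)
  have hmax : (I.comap (algebraMap v.valuationSubring _)).IsMaximal :=
    Ideal.isMaximal_comap_of_isIntegral_of_isMaximal (R := v.valuationSubring) I
  have hm := IsLocalRing.eq_maximalIdeal hmax
  have hW : W.comap (algebraMap K L) = v.valuationSubring := by
    ext a
    rw [ValuationSubring.mem_comap, Valuation.mem_valuationSubring_iff]
    refine ⟨fun ha => ?_, hO a⟩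
    by_contra hlt
    rw [not_le] at hlt
    have hinv : v a⁻¹ < 1 := by rw [map_inv₀]; exact inv_lt_one_of_one_lt₀ hlt
    have h1 : (⟨a⁻¹, hinv.le⟩ : v.valuationSubring) ∈
        IsLocalRing.maximalIdeal v.valuationSubring := (aux_mem_maximal v _).mpr hinv
    rw [← hm, Ideal.mem_comap] at h1
    have h2 : algebraMap v.valuationSubring L ⟨a⁻¹, hinv.le⟩ ∈ W.nonunits := hIW ⟨_, h1, rfl⟩
    rw [aux_algebraMap v, map_inv₀, ValuationSubring.inv_mem_nonunits_iff] at h2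
    rcases h2 with h2 | h2
    · rw [map_eq_zero] at h2
      rw [h2, map_zero] at hlt
      exact absurd hlt (not_lt.mpr zero_le_one)
    · exact h2 ha
  refine ⟨W, hW, (hI.eq_of_le (auxIdeal_isMaximal v W hW).ne_top fun r hr => ?_).symm⟩
  rw [mem_auxIdeal]
  exact hIW ⟨r, hr, rfl⟩

lemma aux_loc [Algebra.IsAlgebraic K L] (W : ValuationSubring L)
    (hW : W.comap (algebraMap K L) = v.valuationSubring) :
    (W : Set L) = {x : L | ∃ a b : integralClosure v.valuationSubring L,
              b ∉ auxIdeal v W hW ∧ (b : L) * x = (a : L)} := by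
  have hle := aux_le v W (fun a ha => (aux_mem_iff v W hW a).mpr ha)
  ext x
  simp only [mem_auxIdeal, Set.mem_setOf_eq, SetLike.mem_coe]
  refine ⟨aux_key v W hW x, ?_⟩
  rintro ⟨a, b, hb, h⟩
  rw [ValuationSubring.mem_nonunits_iff_or, not_or, not_not] at hb
  have : x = (b : L)⁻¹ * a := by rw [← h, inv_mul_cancel_left₀ hb.1]
  rw [this]
  exact mul_mem hb.2 (hle a)

end aux

/-- Let `v` be a valuation on a field `K`, `L` an algebraic extension of `K`, and `R` the
integral closure of the valuation ring `𝒪_v` in `L`.  The maps `I ↦ R_I` (localization of `R`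
at `I`, viewed inside `L`) and `𝒪_w ↦ 𝔪_w ∩ R` are mutually inverse bijections between the
set of maximal ideals of `R` and the set of valuation rings of `L` extending `𝒪_v`. -/
theorem bijection_maximal_ideals_extensions
    {K L Γ₀ : Type*} [Field K] [Field L] [Algebra K L] [Algebra.IsAlgebraic K L]
    [LinearOrderedCommGroupWithZero Γ₀] (v : Valuation K Γ₀)
    [Algebra v.valuationSubring L] [IsScalarTower v.valuationSubring K L] :
    ∃ e : {I : Ideal (integralClosure v.valuationSubring L) // I.IsMaximal}
        ≃ {W : ValuationSubring L // W.comap (algebraMap K L) = v.valuationSubring},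
      (∀ I : {I : Ideal (integralClosure v.valuationSubring L) // I.IsMaximal},
        (((e I : {W : ValuationSubring L //
              W.comap (algebraMap K L) = v.valuationSubring}) : ValuationSubring L) : Set L)
          = {x : L | ∃ a b : integralClosure v.valuationSubring L,
              b ∉ I.1 ∧ (b : L) * x = (a : L)}) ∧
      (∀ W : {W : ValuationSubring L // W.comap (algebraMap K L) = v.valuationSubring},
        ∀ r : integralClosure v.valuationSubring L,
          r ∈ (e.symm W).1 ↔ (r : L) ∈
            Subtype.val '' ((IsLocalRing.maximalIdeal (W : ValuationSubring L)
              : Ideal (W : ValuationSubring L)) : Set (W : ValuationSubring L))) := by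
  classical
  let f : {W : ValuationSubring L // W.comap (algebraMap K L) = v.valuationSubring} →
      {I : Ideal (integralClosure v.valuationSubring L) // I.IsMaximal} :=
    fun W => ⟨auxIdeal v W.1 W.2, auxIdeal_isMaximal v W.1 W.2⟩
  have hf : Function.Bijective f := by
    constructor
    · intro W W' h
      have h' : auxIdeal v W.1 W.2 = auxIdeal v W'.1 W'.2 := congrArg Subtype.val h
      refine Subtype.ext (SetLike.coe_injective ?_)
      rw [aux_loc v W.1 W.2, aux_loc v W'.1 W'.2, h']
    · rintro ⟨I, hI⟩
      obtain ⟨W, hW, h⟩ := aux_exists v I hI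
      exact ⟨⟨W, hW⟩, Subtype.ext h⟩
  refine ⟨(Equiv.ofBijective f hf).symm, ?_, ?_⟩
  · intro I
    obtain ⟨W, rfl⟩ := (Equiv.ofBijective f hf).surjective I
    rw [Equiv.symm_apply_apply]
    exact aux_loc v W.1 W.2
  · intro W r
    rw [ValuationSubring.image_maximalIdeal]
    exact mem_auxIdeal v W.1 W.2 r
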